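/- Let (C•,d) be a cochain complex in 𝒞 and let C̄• be a graded lift of C• along F. Then the following are equivalent: (i) (C•,d) lifts along the induced functor K(F) on homotopy categories, i.e. there exists a cochain complex (D̄•,d̄_D) in 𝒞̄ and a homotopy equivalence between (C•,d) and the image complex F(D̄•,d̄_D); (ii) there exists a differential d̄ on C̄• with F(d̄) = d; (iii) for some (equivalently, every) graded lift d̄₀ of d there exists a graded map ∂ of degree 1 with F(∂) = 0 and d̄₀² + d̄₀∘∂ + ∂∘d̄₀ = 0. -/

import Mathlib

open CategoryTheory

namespace Paper

/-- A graded object: a `ℤ`-indexed family of objects. -/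
abbrev GradedObj (A : Type*) [Category A] := ℤ → A

/-- A graded map of degree `n` from `X` to `Y`. -/
abbrev GMap {A : Type*} [Category A] (X Y : GradedObj A) (n : ℤ) :=
  ∀ i : ℤ, X i ⟶ Y (i + n)

/-- Composition of graded maps, in diagrammatic order (`gcomp h f g` is "`g ∘ f`"),
with prescribed total degree `k = n + m`. -/
def gcomp {A : Type*} [Category A] {X Y Z : GradedObj A} {n m k : ℤ} (h : n + m = k)
    (f : GMap X Y n) (g : GMap Y Z m) : GMap X Z k :=
  fun i => f i ≫ g (i + n) ≫ eqToHom (congrArg Z (show i + n + m = i + k by omega))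

/-- The identity graded map of degree `0`. -/
def gid {A : Type*} [Category A] (X : GradedObj A) : GMap X X 0 :=
  fun i => eqToHom (congrArg X (add_zero i).symm)

/-- `δ(f) = d_Y ∘ f - (-1)ⁿ ⬝ f ∘ d_X` for pre-differentials `d_X`, `d_Y` and a graded
map `f` of degree `n`; the result has degree `m = n + 1`. -/
def gdelta {A : Type*} [Category A] [Preadditive A] {X Y : GradedObj A}
    (dX : GMap X X 1) (dY : GMap Y Y 1) {n m : ℤ} (h : n + 1 = m) (f : GMap X Y n) :
    GMap X Y m :=
  gcomp h f dY - (n.negOnePow : ℤ) • gcomp (show 1 + n = m by omega) dX f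

/-- The image of a graded object under a functor. -/
abbrev Fgr {A B : Type*} [Category A] [Category B] (F : B ⥤ A) (X : GradedObj B) :
    GradedObj A := fun i => F.obj (X i)

/-- The image of a graded map under a functor. -/
def Fmap {A B : Type*} [Category A] [Category B] (F : B ⥤ A) {X Y : GradedObj B} {n : ℤ}
    (f : GMap X Y n) : GMap (Fgr F X) (Fgr F Y) n := fun i => F.map (f i)

/-- `Ker(F)² = 0`: the composite of two `F`-killed morphisms vanishes. -/
def KerSq {A B : Type*} [Category A] [Category B] [Preadditive A] [Preadditive B]
    (F : B ⥤ A) : Prop :=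
  ∀ ⦃X Y Z : B⦄ (u : X ⟶ Y) (v : Y ⟶ Z), F.map u = 0 → F.map v = 0 → u ≫ v = 0

/-- `f : (X,dX) → (Y,dY)` and `g : (Y,dY) → (X,dX)` are cochain maps which are homotopy
inverse to each other. -/
def IsHomotopyEquivPair {A : Type*} [Category A] [Preadditive A] {X Y : GradedObj A}
    (dX : GMap X X 1) (dY : GMap Y Y 1) (f : GMap X Y 0) (g : GMap Y X 0) : Prop :=
  gdelta dX dY (show (0:ℤ) + 1 = 1 by omega) f = 0 ∧
  gdelta dY dX (show (0:ℤ) + 1 = 1 by omega) g = 0 ∧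
  (∃ H : GMap X X (-1), gdelta dX dX (show (-1:ℤ) + 1 = 0 by omega) H
      = gid X - gcomp (show (0:ℤ) + 0 = 0 by omega) f g) ∧
  (∃ K : GMap Y Y (-1), gdelta dY dY (show (-1:ℤ) + 1 = 0 by omega) K
      = gid Y - gcomp (show (0:ℤ) + 0 = 0 by omega) g f)

section GradedMaps

variable {A : Type*} [Category A] {W X Y Z : GradedObj A} {n m l a b k : ℤ}

theorem gcomp_assoc (hnm : n + m = a) (hal : a + l = k) (hml : m + l = b) (hnb : n + b = k)
    (f : GMap W X n) (g : GMap X Y m) (h : GMap Y Z l) :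
    gcomp hal (gcomp hnm f g) h = gcomp hnb f (gcomp hml g h) := by
  have comm {i j : ℤ} (e : i = j) :
      eqToHom (congrArg Y e) ≫ h j = h i ≫ eqToHom (by rw [e]) := by
    subst e; simp
  funext i
  simp only [gcomp, Category.assoc]
  rw [← Category.assoc (eqToHom _) (h _), comm (show i + n + m = i + a by lia)]
  simp

theorem gid_gcomp (h : 0 + n = n) (f : GMap X Y n) : gcomp h (gid X) f = f := by
  have comm {i j : ℤ} (e : i = j) :
      eqToHom (congrArg X e) ≫ f j = f i ≫ eqToHom (by rw [e]) := by
    subst e; simp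
  funext i
  simp only [gcomp, gid]
  rw [← Category.assoc, comm (add_zero i).symm]
  simp

theorem gcomp_gid (h : n + 0 = n) (f : GMap X Y n) : gcomp h f (gid Y) = f := by
  funext i
  simp [gcomp, gid]

section Preadditive

variable [Preadditive A]

theorem gcomp_add (h : n + m = k) (f : GMap X Y n) (g g' : GMap Y Z m) :
    gcomp h f (g + g') = gcomp h f g + gcomp h f g' := by
  funext i
  simp [gcomp]

theorem add_gcomp (h : n + m = k) (f f' : GMap X Y n) (g : GMap Y Z m) :
    gcomp h (f + f') g = gcomp h f g + gcomp h f' g := by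
  funext i
  simp [gcomp]

theorem gcomp_sub (h : n + m = k) (f : GMap X Y n) (g g' : GMap Y Z m) :
    gcomp h f (g - g') = gcomp h f g - gcomp h f g' := by
  funext i
  simp [gcomp]

theorem sub_gcomp (h : n + m = k) (f f' : GMap X Y n) (g : GMap Y Z m) :
    gcomp h (f - f') g = gcomp h f g - gcomp h f' g := by
  funext i
  simp [gcomp]

theorem gcomp_zero (h : n + m = k) (f : GMap X Y n) :
    gcomp h f (0 : GMap Y Z m) = 0 := by
  funext i
  simp [gcomp]

theorem gdelta_zero_eq (dX : GMap X X 1) (dY : GMap Y Y 1) (f : GMap X Y 0) :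
    gdelta dX dY (zero_add 1) f = gcomp (zero_add 1) f dY - gcomp (add_zero 1) dX f := by
  simp [gdelta]

theorem gdelta_neg_one_eq (dX : GMap X X 1) (dY : GMap Y Y 1) (f : GMap X Y (-1)) :
    gdelta dX dY (neg_add_cancel 1) f =
      gcomp (neg_add_cancel 1) f dY + gcomp (add_neg_cancel 1) dX f := by
  simp [gdelta]

theorem isHomotopyEquivPair_gid (d : GMap X X 1) :
    IsHomotopyEquivPair d d (gid X) (gid X) := by
  refine ⟨?_, ?_, ⟨0, ?_⟩, ⟨0, ?_⟩⟩
  all_goals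
    funext i
    simp [gdelta, gid_gcomp, gcomp_gid, gcomp]

end Preadditive

end GradedMaps

section Functor

variable {B C : Type*} [Category B] [Category C] (F : B ⥤ C) {X Y Z : GradedObj B} {n m k : ℤ}

theorem Fmap_surjective [F.Full] (f : GMap (Fgr F X) (Fgr F Y) n) :
    ∃ g : GMap X Y n, Fmap F g = f :=
  ⟨fun i => F.preimage (f i), funext fun i => F.map_preimage (f i)⟩

theorem Fmap_gcomp (h : n + m = k) (f : GMap X Y n) (g : GMap Y Z m) :
    Fmap F (gcomp h f g) = gcomp h (Fmap F f) (Fmap F g) := by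
  funext i
  simp [Fmap, gcomp, eqToHom_map]

theorem Fmap_gid (X : GradedObj B) : Fmap F (gid X) = gid (Fgr F X) := by
  funext i
  simp [Fmap, gid, eqToHom_map]

variable [Preadditive B] [Preadditive C]

theorem Fmap_add [F.Additive] (f g : GMap X Y n) : Fmap F (f + g) = Fmap F f + Fmap F g :=
  funext fun _ => F.map_add

theorem Fmap_sub [F.Additive] (f g : GMap X Y n) : Fmap F (f - g) = Fmap F f - Fmap F g :=
  funext fun _ => F.map_sub

variable {F}

theorem KerSq.gcomp_eq_zero (hF : KerSq F) (h : n + m = k) {f : GMap X Y n} {g : GMap Y Z m}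
    (hf : Fmap F f = 0) (hg : Fmap F g = 0) : gcomp h f g = 0 := by
  funext i
  simp only [gcomp]
  rw [← Category.assoc, hF (f i) (g (i + n)) (congrFun hf i) (congrFun hg (i + n))]
  simp

/-- Changing a pre-differential `d₀` by an `F`-killed `p` changes its square by
`d₀ ∘ p + p ∘ d₀`. -/
theorem KerSq.gcomp_add_self (hF : KerSq F) (d₀ : GMap X X 1) {p : GMap X X 1}
    (hp : Fmap F p = 0) :
    gcomp (show (1 : ℤ) + 1 = 2 by lia) (d₀ + p) (d₀ + p) =
      gcomp (show (1 : ℤ) + 1 = 2 by lia) d₀ d₀ + gcomp (show (1 : ℤ) + 1 = 2 by lia) p d₀ +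
        gcomp (show (1 : ℤ) + 1 = 2 by lia) d₀ p := by
  rw [gcomp_add, add_gcomp, add_gcomp, hF.gcomp_eq_zero _ hp hp, add_zero]

/-- If a complex of the target category is a homotopy retract of the image of a complex, then
the obstruction `d₀²` to lifting its differential is the coboundary of an `F`-killed map. -/
theorem KerSq.exists_correction [F.Additive] (hF : KerSq F) (d₀ : GMap X X 1)
    (D : GMap Y Y 1) (φ : GMap X Y 0) (ψ : GMap Y X 0) (H : GMap X X (-1))
    (hd : Fmap F (gcomp (show (1 : ℤ) + 1 = 2 by lia) d₀ d₀) = 0)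
    (hD : gcomp (show (1 : ℤ) + 1 = 2 by lia) D D = 0)
    (hφ : Fmap F (gcomp (zero_add 1) φ D - gcomp (add_zero 1) d₀ φ) = 0)
    (hψ : Fmap F (gcomp (zero_add 1) ψ d₀ - gcomp (add_zero 1) D ψ) = 0)
    (hH : Fmap F (gid X - gcomp (add_zero 0) φ ψ -
      (gcomp (neg_add_cancel 1) H d₀ + gcomp (add_neg_cancel 1) d₀ H)) = 0) :
    ∃ p : GMap X X 1, Fmap F p = 0 ∧
      gcomp (show (1 : ℤ) + 1 = 2 by lia) d₀ d₀ + gcomp (show (1 : ℤ) + 1 = 2 by lia) p d₀ +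
        gcomp (show (1 : ℤ) + 1 = 2 by lia) d₀ p = 0 := by
  have h11 : (1 : ℤ) + 1 = 2 := by lia
  have h21 : (2 : ℤ) + -1 = 1 := by lia
  have h111 : (1 : ℤ) + 2 = 3 := by lia
  have h112 : (2 : ℤ) + 1 = 3 := by lia
  set ω := gcomp h11 d₀ d₀ with hω
  set α := gcomp (zero_add 1) φ D - gcomp (add_zero 1) d₀ φ with hα
  refine ⟨gcomp (add_zero 1) α ψ - gcomp h21 ω H, ?_, ?_⟩
  · rw [Fmap_sub, Fmap_gcomp, Fmap_gcomp, hφ, hd]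
    funext i
    simp [gcomp]
  have hdω : gcomp h111 d₀ ω = gcomp h112 ω d₀ := (gcomp_assoc ..).symm
  -- `δ α` is `-φ ∘ ω`
  have hδα : gcomp h11 α D + gcomp h11 d₀ α = -gcomp (add_zero 2) ω φ := by
    rw [hα, sub_gcomp, gcomp_sub, gcomp_assoc _ h11 h11 (zero_add 2), hD, gcomp_zero,
      gcomp_assoc _ h11 (zero_add 1) h11, hω, ← gcomp_assoc h11 (add_zero 2) (add_zero 1) h11]
    abel
  have hαψ : gcomp h11 (gcomp (add_zero 1) α ψ) d₀ =
      gcomp (add_zero 2) (gcomp h11 α D) ψ := by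
    have := hF.gcomp_eq_zero h11 hφ hψ
    rw [gcomp_sub, sub_eq_zero] at this
    rw [gcomp_assoc _ h11 (zero_add 1) h11, this,
      gcomp_assoc h11 (add_zero 2) (add_zero 1) h11]
  have hωκ := hF.gcomp_eq_zero (add_zero 2) hd hH
  rw [gcomp_sub, gcomp_sub, gcomp_add, gcomp_gid, sub_eq_zero, sub_eq_iff_eq_add,
    ← gcomp_assoc h21 h11 (neg_add_cancel 1) (add_zero 2),
    ← gcomp_assoc h112 (show (3 : ℤ) + -1 = 2 by lia) (add_neg_cancel 1) (add_zero 2),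
    ← gcomp_assoc (add_zero 2) (add_zero 2) (add_zero 0) (add_zero 2)] at hωκ
  have hdωH : gcomp h11 d₀ (gcomp h21 ω H) =
      gcomp (show (3 : ℤ) + -1 = 2 by lia) (gcomp h112 ω d₀) H := by
    rw [← hdω]
    exact (gcomp_assoc ..).symm
  have hsum : gcomp (add_zero 2) (gcomp h11 α D) ψ + gcomp h11 d₀ (gcomp (add_zero 1) α ψ) =
      -gcomp (add_zero 2) (gcomp (add_zero 2) ω φ) ψ := by
    rw [← gcomp_assoc h11 (add_zero 2) (add_zero 1) h11, ← add_gcomp, hδα]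
    funext i
    simp [gcomp]
  rw [sub_gcomp, gcomp_sub, hαψ, hdωH]
  nth_rewrite 1 [hωκ]
  rw [← sub_eq_zero.mpr hsum]
  abel

end Functor

/-- for a complex `(C,d)` with a fixed graded lift `C̄`, the following are
equivalent: (i) `(C,d)` lifts along `K(F)` (up to homotopy equivalence); (ii) `d` lifts to
a differential on `C̄`; (iii) for some, equivalently every, graded lift `d̄₀` of `d` there
is an `F`-killed `∂` of degree `1` with `d̄₀² + d̄₀∘∂ + ∂∘d̄₀ = 0`. -/
theorem statement14 {B C : Type*} [Category B] [Preadditive B] [Category C] [Preadditive C]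
    (F : B ⥤ C) [F.Additive] [F.Full] (hF : KerSq F)
    (Xb : GradedObj B)
    (d : GMap (Fgr F Xb) (Fgr F Xb) 1)
    (hd : gcomp (show (1:ℤ) + 1 = 2 by omega) d d = 0) :
    -- (i) ↔ (ii)
    ((∃ (Yb : GradedObj B) (dYb : GMap Yb Yb 1),
        gcomp (show (1:ℤ) + 1 = 2 by omega) dYb dYb = 0 ∧
        ∃ (φ : GMap (Fgr F Xb) (Fgr F Yb) 0) (ψ : GMap (Fgr F Yb) (Fgr F Xb) 0),
          IsHomotopyEquivPair d (Fmap F dYb) φ ψ) ↔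
      (∃ db : GMap Xb Xb 1, Fmap F db = d ∧
        gcomp (show (1:ℤ) + 1 = 2 by omega) db db = 0)) ∧
    -- (ii) ↔ (iii, for some graded lift)
    ((∃ db : GMap Xb Xb 1, Fmap F db = d ∧
        gcomp (show (1:ℤ) + 1 = 2 by omega) db db = 0) ↔
      (∃ d0 : GMap Xb Xb 1, Fmap F d0 = d ∧
        ∃ p : GMap Xb Xb 1, Fmap F p = 0 ∧
          gcomp (show (1:ℤ) + 1 = 2 by omega) d0 d0
            + gcomp (show (1:ℤ) + 1 = 2 by omega) p d0
            + gcomp (show (1:ℤ) + 1 = 2 by omega) d0 p = 0)) ∧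
    -- (iii, for some) ↔ (iii, for every graded lift)
    ((∃ d0 : GMap Xb Xb 1, Fmap F d0 = d ∧
        ∃ p : GMap Xb Xb 1, Fmap F p = 0 ∧
          gcomp (show (1:ℤ) + 1 = 2 by omega) d0 d0
            + gcomp (show (1:ℤ) + 1 = 2 by omega) p d0
            + gcomp (show (1:ℤ) + 1 = 2 by omega) d0 p = 0) ↔
      (∀ d0 : GMap Xb Xb 1, Fmap F d0 = d →
        ∃ p : GMap Xb Xb 1, Fmap F p = 0 ∧
          gcomp (show (1:ℤ) + 1 = 2 by omega) d0 d0
            + gcomp (show (1:ℤ) + 1 = 2 by omega) p d0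
            + gcomp (show (1:ℤ) + 1 = 2 by omega) d0 p = 0)) := by
  have correction_of_lift {d₀ d₁ : GMap Xb Xb 1} (h₀ : Fmap F d₀ = d) (h₁ : Fmap F d₁ = d)
      (hsq : gcomp (show (1 : ℤ) + 1 = 2 by lia) d₁ d₁ = 0) :
      ∃ p : GMap Xb Xb 1, Fmap F p = 0 ∧
        gcomp (show (1 : ℤ) + 1 = 2 by lia) d₀ d₀ + gcomp (show (1 : ℤ) + 1 = 2 by lia) p d₀ +
          gcomp (show (1 : ℤ) + 1 = 2 by lia) d₀ p = 0 := by
    have hp : Fmap F (d₁ - d₀) = 0 := by rw [Fmap_sub, h₀, h₁, sub_self]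
    exact ⟨d₁ - d₀, hp, by rw [← hF.gcomp_add_self d₀ hp, add_sub_cancel, hsq]⟩
  have lift_of_correction {d₀ p : GMap Xb Xb 1} (h₀ : Fmap F d₀ = d) (hp : Fmap F p = 0)
      (h : gcomp (show (1 : ℤ) + 1 = 2 by lia) d₀ d₀ +
        gcomp (show (1 : ℤ) + 1 = 2 by lia) p d₀ +
          gcomp (show (1 : ℤ) + 1 = 2 by lia) d₀ p = 0) :
      ∃ db : GMap Xb Xb 1, Fmap F db = d ∧
        gcomp (show (1 : ℤ) + 1 = 2 by lia) db db = 0 :=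
    ⟨d₀ + p, by rw [Fmap_add, h₀, hp, add_zero], by rw [hF.gcomp_add_self d₀ hp, h]⟩
  refine ⟨⟨?_, ?_⟩, ⟨?_, ?_⟩, ⟨?_, ?_⟩⟩
  · rintro ⟨Yb, D, hD, φ', ψ', hφ, hψ, ⟨H', hH⟩, -⟩
    obtain ⟨d₀, rfl⟩ := Fmap_surjective F d
    obtain ⟨φ, rfl⟩ := Fmap_surjective F φ'
    obtain ⟨ψ, rfl⟩ := Fmap_surjective F ψ'
    obtain ⟨H, rfl⟩ := Fmap_surjective F H'
    rw [gdelta_zero_eq] at hφ hψ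
    rw [gdelta_neg_one_eq] at hH
    obtain ⟨p, hp, h⟩ := hF.exists_correction d₀ D φ ψ H
      (by rw [Fmap_gcomp, hd]) hD
      (by rw [Fmap_sub, Fmap_gcomp, Fmap_gcomp, hφ])
      (by rw [Fmap_sub, Fmap_gcomp, Fmap_gcomp, hψ])
      (by
        simp only [Fmap_sub, Fmap_add, Fmap_gcomp, Fmap_gid]
        rw [hH, sub_self])
    exact lift_of_correction rfl hp h
  · rintro ⟨db, rfl, hdb⟩
    exact ⟨Xb, db, hdb, gid _, gid _, isHomotopyEquivPair_gid _⟩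
  · rintro ⟨db, hdb, hsq⟩
    exact ⟨db, hdb, correction_of_lift hdb hdb hsq⟩
  · rintro ⟨d₀, h₀, p, hp, h⟩
    exact lift_of_correction h₀ hp h
  · rintro ⟨d₀, h₀, p, hp, h⟩ d₀' h₀'
    obtain ⟨d₁, h₁, hsq⟩ := lift_of_correction h₀ hp h
    exact correction_of_lift h₀' h₁ hsq
  · intro h
    obtain ⟨d₀, h₀⟩ := Fmap_surjective F d
    exact ⟨d₀, h₀, h d₀ h₀⟩

end Paper
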